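/- arXiv:2412.14362 — 4 statements merged into one kernel-verified Lean document; each statement's English description precedes it below -/
import Mathlib

section
/- For every integer s ≥ 1, the Radau polynomial p_s has exactly s distinct real roots, all of which lie in the half-open interval (0,1]. -/
open Polynomial

/-- The Radau polynomial of index `s`:
`p_s(x) = (d/dx)^(s-1) [x^(s-1) (x-1)^s]`. -/
noncomputable def radauPoly (s : ℕ) : Polynomial ℝ :=
  derivative^[s - 1] (X ^ (s - 1) * (X - 1) ^ s)

theorem iterate_derivative_ne_zero_of_le_natDegree {R : Type*} [Semiring R]
    [IsAddTorsionFree R] {p : R[X]} (hp : p ≠ 0) {k : ℕ} (hk : k ≤ p.natDegree) :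
    derivative^[k] p ≠ 0 := by
  intro h
  have h1 := congrArg (fun q => q.coeff (p.natDegree - k)) h
  simp only [coeff_iterate_derivative, coeff_zero, Nat.sub_add_cancel hk] at h1
  rcases smul_eq_zero.1 h1 with h2 | h2
  · exact absurd (Nat.descFactorial_eq_zero_iff_lt.1 h2) (not_lt.2 hk)
  · exact hp (leadingCoeff_eq_zero.1 h2)

theorem isRoot_iterate_derivative_of_pow_dvd {R : Type*} [CommRing R] {p : R[X]} {a : R}
    {m k : ℕ} (hp : (X - C a) ^ m ∣ p) (hk : k < m) : (derivative^[k] p).IsRoot a :=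
  dvd_iff_isRoot.1 ((dvd_pow_self _ (Nat.sub_ne_zero_of_lt hk)).trans
    (pow_sub_dvd_iterate_derivative_of_pow_dvd k hp))

/-- If a polynomial vanishes at both endpoints of an interval, its derivative has at least one
more root in the open interval than the polynomial itself. -/
theorem card_roots_Ioo_succ_le_derivative {p : ℝ[X]} (hp : derivative p ≠ 0) {a b : ℝ}
    (hab : a < b) (ha : p.IsRoot a) (hb : p.IsRoot b) :
    (p.roots.toFinset.filter (· ∈ Set.Ioo a b)).card + 1 ≤
      ((derivative p).roots.toFinset.filter (· ∈ Set.Ioo a b)).card := by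
  have hp0 : p ≠ 0 := ne_of_apply_ne derivative (by rwa [derivative_zero])
  set S := p.roots.toFinset.filter (· ∈ Set.Ioo a b) with hS
  have hbS : b ∉ S := by simp [hS]
  have haS : a ∉ insert b S := by simp [hS, hab.ne]
  have hroot : ∀ x ∈ insert a (insert b S), p.IsRoot x ∧ x ∈ Set.Icc a b := by
    intro x hx
    rcases Finset.mem_insert.1 hx with rfl | hx
    · exact ⟨ha, le_rfl, hab.le⟩
    rcases Finset.mem_insert.1 hx with rfl | hx
    · exact ⟨hb, hab.le, le_rfl⟩
    rw [hS, Finset.mem_filter, Multiset.mem_toFinset, mem_roots hp0] at hx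
    exact ⟨hx.1, Set.Ioo_subset_Icc_self hx.2⟩
  have hcard := Finset.card_le_of_interleaved (s := insert a (insert b S))
    (t := (derivative p).roots.toFinset.filter (· ∈ Set.Ioo a b)) fun x hx y hy hxy _ => by
      obtain ⟨hx0, hx1⟩ := hroot x hx
      obtain ⟨hy0, hy1⟩ := hroot y hy
      obtain ⟨z, hz, hz0⟩ := exists_deriv_eq_zero hxy p.continuousOn (hx0.trans hy0.symm)
      refine ⟨z, ?_, hz⟩
      rw [Finset.mem_filter, Multiset.mem_toFinset, mem_roots hp, IsRoot, ← p.deriv]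
      exact ⟨hz0, hx1.1.trans_lt hz.1, hz.2.trans_le hy1.2⟩
  rw [Finset.card_insert_of_notMem haS, Finset.card_insert_of_notMem hbS] at hcard
  omega

/-- A polynomial divisible by `(X - a) ^ n` and by `(X - b) ^ n` has a `k`-th derivative with at
least `k` distinct roots strictly between `a` and `b`, for every `k ≤ n`. -/
theorem le_card_roots_Ioo_iterate_derivative {p : ℝ[X]} (hp : p ≠ 0) {a b : ℝ} (hab : a < b)
    {n : ℕ} (ha : (X - C a) ^ n ∣ p) (hb : (X - C b) ^ n ∣ p) {k : ℕ} (hk : k ≤ n) :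
    k ≤ ((derivative^[k] p).roots.toFinset.filter (· ∈ Set.Ioo a b)).card := by
  have hn : n ≤ p.natDegree := by
    simpa [natDegree_pow] using natDegree_le_of_dvd ha hp
  induction k with
  | zero => exact Nat.zero_le _
  | succ k ih =>
    have h0 := iterate_derivative_ne_zero_of_le_natDegree hp (hk.trans hn)
    rw [Function.iterate_succ_apply'] at h0 ⊢
    exact (Nat.succ_le_succ (ih (Nat.le_of_succ_le hk))).trans
      (card_roots_Ioo_succ_le_derivative h0 hab
        (isRoot_iterate_derivative_of_pow_dvd ha hk) (isRoot_iterate_derivative_of_pow_dvd hb hk))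

/-- For every integer `s ≥ 1`, the Radau polynomial `p_s` has exactly `s`
distinct real roots, all lying in the half-open interval `(0, 1]`. -/
theorem radauPoly_roots_count_and_location (s : ℕ) (hs : 1 ≤ s) :
    {x : ℝ | (radauPoly s).IsRoot x}.ncard = s ∧
      {x : ℝ | (radauPoly s).IsRoot x} ⊆ Set.Ioc 0 1 := by
  obtain ⟨n, rfl⟩ : ∃ n, s = n + 1 := ⟨s - 1, by omega⟩
  rw [radauPoly, Nat.add_sub_cancel]
  set f : ℝ[X] := X ^ n * (X - 1) ^ (n + 1) with hf
  have hfm : f.Monic := (monic_X_pow n).mul ((monic_X_sub_C (1 : ℝ)).pow (n + 1))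
  have hdeg : f.natDegree = n + (n + 1) := by
    rw [hf, ← C_1, (monic_X_pow n).natDegree_mul ((monic_X_sub_C (1 : ℝ)).pow (n + 1)),
      natDegree_X_pow, natDegree_pow, natDegree_X_sub_C, mul_one]
  have h1 : (X - C 1) ^ (n + 1) ∣ f := by rw [C_1]; exact dvd_mul_left _ _
  have h0 : (X - C 0) ^ n ∣ f := by rw [C_0, sub_zero]; exact dvd_mul_right _ _
  have hne := iterate_derivative_ne_zero_of_le_natDegree hfm.ne_zero (k := n) (by omega)
  have hlow := le_card_roots_Ioo_iterate_derivative hfm.ne_zero zero_lt_one h0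
    ((pow_dvd_pow _ n.le_succ).trans h1) le_rfl
  have hroot := isRoot_iterate_derivative_of_pow_dvd h1 n.lt_succ_self
  have hup : (derivative^[n] f).roots.toFinset.card ≤ n + 1 :=
    (Multiset.toFinset_card_le _).trans ((card_roots' _).trans
      ((natDegree_iterate_derivative f n).trans (by omega)))
  set g := derivative^[n] f
  set T := g.roots.toFinset.filter (· ∈ Set.Ioo (0 : ℝ) 1) with hT
  have h1T : (1 : ℝ) ∉ T := by simp [hT]
  have hsub : insert 1 T ⊆ g.roots.toFinset :=
    Finset.insert_subset (by rwa [Multiset.mem_toFinset, mem_roots hne])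
      (Finset.filter_subset _ _)
  have hcard : (insert 1 T).card = T.card + 1 := Finset.card_insert_of_notMem h1T
  have heq : insert 1 T = g.roots.toFinset := Finset.eq_of_subset_of_card_le hsub (by omega)
  have hset : {x : ℝ | g.IsRoot x} = ((insert 1 T : Finset ℝ) : Set ℝ) := by
    ext x
    rw [heq, Finset.mem_coe, Multiset.mem_toFinset, mem_roots hne, Set.mem_ofPred_eq]
  rw [hset, Set.ncard_coe_finset]
  refine ⟨by have := Finset.card_le_card hsub; omega, fun x hx => ?_⟩
  rcases Finset.mem_insert.1 (Finset.mem_coe.1 hx) with rfl | hx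
  · exact ⟨zero_lt_one, le_rfl⟩
  · exact Set.Ioo_subset_Ioc_self (Finset.mem_filter.1 hx).2
end

section
/- Let s ≥ 1 and let c_1, …, c_s be the (pairwise distinct) roots of the Radau polynomial p_s, and let b ∈ ℝ^s satisfy the order-s quadrature conditions ∑_{j=1}^s b_j c_j^{k−1} = 1/k for k = 1, …, s. Then the quadrature rule is exact to degree 2s−2: for every real polynomial q of degree at most 2s−2, ∑_{j=1}^s b_j q(c_j) = ∫₀¹ q(x) dx; equivalently ∑_{j=1}^s b_j c_j^{k−1} = 1/k for all k = 1, …, 2s−1. -/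
open Polynomial

/-- A quadrature rule that is exact on the monomials of degree less than `s` is exact on all
polynomials of degree less than `s`. -/
theorem quadrature_exact_of_natDegree_lt {ι : Type*} [Fintype ι] {s : ℕ} {b c : ι → ℝ}
    (hb : ∀ k < s, ∑ j, b j * c j ^ k = 1 / ((k : ℝ) + 1)) {r : ℝ[X]} (hr : r.natDegree < s) :
    ∑ j, b j * r.eval (c j) = ∫ x in (0 : ℝ)..1, r.eval x := by
  simp only [eval_eq_sum_range]
  rw [intervalIntegral.integral_finsetSum
    fun i _ => Continuous.intervalIntegrable (by fun_prop) _ _]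
  simp only [Finset.mul_sum]
  rw [Finset.sum_comm]
  refine Finset.sum_congr rfl fun k hk => ?_
  rw [intervalIntegral.integral_const_mul, integral_pow, zero_pow k.succ_ne_zero, one_pow, sub_zero,
    ← hb k (by grind), Finset.mul_sum]
  exact Finset.sum_congr rfl fun j _ => by ring

/-- If `F` vanishes to order `n` at `0` and at `1`, then its `n`-th derivative is orthogonal on
`[0, 1]` to all polynomials of degree less than `n`. -/
theorem integral_iterate_derivative_mul_eq_zero {n : ℕ} {F r : ℝ[X]} (h₀ : X ^ n ∣ F)
    (h₁ : (X - 1) ^ n ∣ F) (hr : r.degree < n) :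
    ∫ x in (0 : ℝ)..1, (derivative^[n] F).eval x * r.eval x = 0 := by
  induction n generalizing r with
  | zero => simp [show r = 0 by simpa [degree_lt_iff_coeff_zero, Polynomial.ext_iff] using hr]
  | succ n ih =>
    have e₀ : (derivative^[n] F).eval 0 = 0 := by
      simpa [dvd_iff_isRoot, X_dvd_iff, coeff_zero_eq_eval_zero] using
        pow_sub_dvd_iterate_derivative_of_pow_dvd n h₀
    have e₁ : (derivative^[n] F).eval 1 = 0 := by
      have h := pow_sub_dvd_iterate_derivative_of_pow_dvd n h₁
      rw [Nat.add_sub_cancel_left, pow_one, ← C_1, dvd_iff_isRoot] at h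
      exact h
    have hd : r.derivative.degree < n := by
      rw [degree_lt_iff_coeff_zero] at hr ⊢
      intro m hm
      simp [coeff_derivative, hr (m + 1) (by omega)]
    have hp := intervalIntegral.integral_deriv_mul_eq_sub (a := 0) (b := 1)
      (fun x _ => (derivative^[n] F).hasDerivAt x) (fun x _ => r.hasDerivAt x)
      (Continuous.intervalIntegrable (by fun_prop) _ _)
      (Continuous.intervalIntegrable (by fun_prop) _ _)
    rw [intervalIntegral.integral_add (Continuous.intervalIntegrable (by fun_prop) _ _)
      (Continuous.intervalIntegrable (by fun_prop) _ _), e₀, e₁,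
      ih ((pow_dvd_pow _ n.le_succ).trans h₀) ((pow_dvd_pow _ n.le_succ).trans h₁) hd] at hp
    rw [Function.iterate_succ_apply']
    simpa using hp

theorem natDegree_iterate_derivative_eq {R : Type*} [Semiring R] [IsAddTorsionFree R]
    (p : R[X]) (k : ℕ) :
    (derivative^[k] p).natDegree = p.natDegree - k := by
  induction k with
  | zero => simp
  | succ k ih => rw [Function.iterate_succ_apply', natDegree_derivative, ih, Nat.sub_sub]

theorem natDegree_radauPoly {s : ℕ} (hs : 1 ≤ s) : (radauPoly s).natDegree = s := by
  rw [radauPoly, natDegree_iterate_derivative_eq, ← C_1,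
    natDegree_mul (by simp) (pow_ne_zero _ (X_sub_C_ne_zero 1)),
    natDegree_pow, natDegree_pow, natDegree_X, natDegree_X_sub_C]
  omega

/-- The Radau polynomial of index `s` is orthogonal on `[0, 1]` to all polynomials of degree less
than `s - 1`. -/
theorem integral_radauPoly_mul_eq_zero {s : ℕ} {r : ℝ[X]} (hr : r.degree < (s - 1 : ℕ)) :
    ∫ x in (0 : ℝ)..1, (radauPoly s).eval x * r.eval x = 0 :=
  integral_iterate_derivative_mul_eq_zero (dvd_mul_right _ _)
    ((pow_dvd_pow _ (Nat.sub_le s 1)).trans (dvd_mul_left _ _)) hr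

/-- If `c_1, …, c_s` are the pairwise distinct roots of the Radau polynomial
`p_s` and `b` satisfies the order-`s` quadrature conditions
`∑ⱼ bⱼ cⱼ^(k-1) = 1/k` for `k = 1, …, s`, then the quadrature rule is exact to
degree `2s - 2`: `∑ⱼ bⱼ q(cⱼ) = ∫₀¹ q` for every polynomial `q` with
`deg q ≤ 2s - 2`; equivalently `∑ⱼ bⱼ cⱼ^(k-1) = 1/k` for all `k = 1, …, 2s-1`. -/
theorem radau_quadrature_superconvergence (s : ℕ) (hs : 1 ≤ s)
    (c : Fin s → ℝ) (hc : Function.Injective c)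
    (hroot : ∀ j, (radauPoly s).IsRoot (c j))
    (hall : ∀ x : ℝ, (radauPoly s).IsRoot x → x ∈ Set.range c)
    (b : Fin s → ℝ)
    (hb : ∀ k : ℕ, 1 ≤ k → k ≤ s → ∑ j, b j * c j ^ (k - 1) = 1 / (k : ℝ)) :
    (∀ q : Polynomial ℝ, q.degree ≤ (2 * s - 2 : ℕ) →
        ∑ j, b j * q.eval (c j) = ∫ x in (0:ℝ)..1, q.eval x) ∧
      (∀ k : ℕ, 1 ≤ k → k ≤ 2 * s - 1 →
        ∑ j, b j * c j ^ (k - 1) = 1 / (k : ℝ)) := by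
  have exact_of_degree_le (q : ℝ[X]) (hq : q.degree ≤ (2 * s - 2 : ℕ)) :
      ∑ j, b j * q.eval (c j) = ∫ x in (0 : ℝ)..1, q.eval x := by
    have hdeg := natDegree_radauPoly hs
    have hdiv : (q / radauPoly s).degree < (s - 1 : ℕ) := by
      rcases eq_or_ne (q / radauPoly s) 0 with h | h
      · simp [h]
      rw [← natDegree_lt_iff_degree_lt h]
      have hp : radauPoly s ≠ 0 := ne_zero_of_natDegree_gt (n := 0) (by omega)
      have hle : (radauPoly s).degree ≤ q.degree :=
        not_lt.mp (mt (Polynomial.div_eq_zero_iff hp).mpr h)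
      have hsum := (degree_add_div hp hle).trans_le hq
      rw [degree_eq_natDegree hp, degree_eq_natDegree h, hdeg] at hsum
      norm_cast at hsum
      omega
    have hmod : (q % radauPoly s).natDegree < s := by
      have := natDegree_mod_lt q (q := radauPoly s) (by omega)
      omega
    have heval (x : ℝ) : q.eval x =
        (radauPoly s).eval x * (q / radauPoly s).eval x + (q % radauPoly s).eval x := by
      rw [← eval_mul, ← eval_add, EuclideanDomain.div_add_mod]
    have hexact := quadrature_exact_of_natDegree_lt (b := b) (c := c)
      (fun k hk => by simpa using hb (k + 1) (by omega) hk) hmod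
    simp only [heval]
    rw [intervalIntegral.integral_add (Continuous.intervalIntegrable (by fun_prop) _ _)
      (Continuous.intervalIntegrable (by fun_prop) _ _), integral_radauPoly_mul_eq_zero hdiv,
      zero_add, ← hexact]
    exact Finset.sum_congr rfl fun j _ => by rw [(hroot j).eq_zero, zero_mul, zero_add]
  refine ⟨exact_of_degree_le, fun k hk hks => ?_⟩
  obtain ⟨k, rfl⟩ := Nat.exists_eq_add_of_le' hk
  have h := exact_of_degree_le (X ^ k) (by rw [degree_X_pow]; exact_mod_cast (by omega))
  simpa [integral_pow] using h
end

section
/- Let c_1, …, c_s be pairwise distinct nonzero real numbers and let a be the s×s matrix satisfying the simplifying condition C(s): ∑_{j=1}^s a_{ij} c_j^{k−1} = c_i^k/k for k = 1, …, s. Then a is invertible and det a = (∏_{i=1}^s c_i) / s!. -/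
/-- If `c_1, …, c_s` are pairwise distinct nonzero reals and `a` satisfies the
simplifying condition `C(s)`, then `a` is invertible and
`det a = (∏ᵢ cᵢ) / s!`. -/
theorem simplifying_condition_det (s : ℕ) (c : Fin s → ℝ)
    (hc : Function.Injective c) (hne : ∀ i, c i ≠ 0)
    (a : Matrix (Fin s) (Fin s) ℝ)
    (ha : ∀ i, ∀ k : ℕ, 1 ≤ k → k ≤ s →
      ∑ j, a i j * c j ^ (k - 1) = c i ^ k / (k : ℝ)) :
    IsUnit a.det ∧ a.det = (∏ i, c i) / (Nat.factorial s : ℝ) := by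
  have hmul : a * Matrix.vandermonde c =
      Matrix.diagonal c * Matrix.vandermonde c *
        Matrix.diagonal (fun k : Fin s => (((k : ℕ) + 1 : ℕ) : ℝ)⁻¹) := by
    ext i k
    have h := ha i (k + 1) (by omega) (by omega)
    rw [Matrix.mul_diagonal, Matrix.diagonal_mul, Matrix.mul_apply]
    simp only [Matrix.vandermonde_apply]
    rw [Nat.add_sub_cancel] at h
    rw [h, pow_succ', div_eq_mul_inv]
  have hfact : ∏ k : Fin s, (((k : ℕ) + 1 : ℕ) : ℝ)⁻¹ = (Nat.factorial s : ℝ)⁻¹ := by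
    rw [Finset.prod_inv_distrib, ← Nat.cast_prod,
      Fin.prod_univ_eq_prod_range (fun k => k + 1) s, Finset.prod_range_add_one_eq_factorial]
  have hdet : a.det = (∏ i, c i) / (Nat.factorial s : ℝ) := by
    apply mul_right_cancel₀ (Matrix.det_vandermonde_ne_zero_iff.mpr hc)
    rw [← Matrix.det_mul, hmul, Matrix.det_mul, Matrix.det_mul, Matrix.det_diagonal,
      Matrix.det_diagonal, hfact]
    ring
  refine ⟨?_, hdet⟩
  rw [hdet, isUnit_iff_ne_zero]
  exact div_ne_zero (Finset.prod_ne_zero_iff.mpr fun i _ => hne i)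
    (Nat.cast_ne_zero.mpr s.factorial_ne_zero)
end

section
/- Let s ≥ 1, let c_1, …, c_s be the roots of the Radau polynomial p_s and let a be the unique s×s real matrix satisfying C(s). Then every eigenvalue λ ∈ ℂ of a (equivalently, every root of the characteristic polynomial of a over ℂ) satisfies Re λ > 0; consequently every eigenvalue of a^{−1} has strictly positive real part. -/
open Polynomial

/-- The linear functional `f ↦ ∫₀¹ f` on real polynomials. -/
noncomputable def unitIntegral : ℝ[X] →ₗ[ℝ] ℝ where
  toFun f := ∫ x in (0 : ℝ)..1, f.eval x
  map_add' f g := by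
    simp only [eval_add]
    exact intervalIntegral.integral_add (f.continuous.intervalIntegrable _ _)
      (g.continuous.intervalIntegrable _ _)
  map_smul' r f := by simp

theorem unitIntegral_apply (f : ℝ[X]) : unitIntegral f = ∫ x in (0 : ℝ)..1, f.eval x := rfl

theorem unitIntegral_derivative (f : ℝ[X]) :
    unitIntegral (derivative f) = f.eval 1 - f.eval 0 :=
  intervalIntegral.integral_eq_sub_of_hasDerivAt (fun x _ => f.hasDerivAt x)
    ((derivative f).continuous.intervalIntegrable _ _)

theorem unitIntegral_mul_self_nonneg (f : ℝ[X]) : 0 ≤ unitIntegral (f * f) := by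
  rw [unitIntegral_apply]
  exact intervalIntegral.integral_nonneg zero_le_one fun x _ => by
    simpa using mul_self_nonneg (f.eval x)

theorem unitIntegral_mul_derivative_nonneg (f : ℝ[X]) (hf : f.eval 0 = 0) :
    0 ≤ unitIntegral (f * derivative f) := by
  have h := unitIntegral_derivative (f * f)
  rw [derivative_mul, mul_comm (derivative f), map_add, eval_mul, eval_mul, hf] at h
  nlinarith [mul_self_nonneg (f.eval 1)]

/-- Repeated integration by parts when all boundary terms vanish. -/
theorem unitIntegral_iterate_derivative_mul (W : ℝ[X]) (m : ℕ)
    (h0 : ∀ k < m, (derivative^[k] W).eval 0 = 0) (h1 : ∀ k < m, (derivative^[k] W).eval 1 = 0)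
    (g : ℝ[X]) :
    unitIntegral (derivative^[m] W * g) = (-1) ^ m * unitIntegral (W * derivative^[m] g) := by
  induction m generalizing g with
  | zero => simp
  | succ m ih =>
    have h := unitIntegral_derivative (derivative^[m] W * g)
    rw [derivative_mul, map_add, eval_mul, eval_mul, h0 m m.lt_succ_self, h1 m m.lt_succ_self,
      ih (fun k hk => h0 k (hk.trans m.lt_succ_self)) (fun k hk => h1 k (hk.trans m.lt_succ_self)),
      ← Function.iterate_succ_apply, ← Function.iterate_succ_apply' derivative] at h
    rw [pow_succ]
    linarith

theorem eval_iterate_derivative_eq_zero_of_pow_dvd {W : ℝ[X]} {x : ℝ} {n k : ℕ}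
    (h : (X - C x) ^ n ∣ W) (hk : k < n) : (derivative^[k] W).eval x = 0 := by
  have h' := pow_sub_dvd_iterate_derivative_of_pow_dvd k h
  exact dvd_iff_isRoot.mp ((dvd_pow_self _ (Nat.sub_ne_zero_of_lt hk)).trans h')

theorem iterate_derivative_eq_C_of_natDegree_le {g : ℝ[X]} {n : ℕ} (hg : g.natDegree ≤ n) :
    derivative^[n] g = C ((n.factorial : ℝ) * g.coeff n) := by
  have h := natDegree_iterate_derivative g n
  rw [Nat.sub_eq_zero_of_le hg, Nat.le_zero] at h
  rw [eq_C_of_natDegree_eq_zero h, coeff_iterate_derivative]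
  simp [Nat.descFactorial_self]

/-- The Radau polynomial annihilates lower degrees, and pairs negatively with `X ^ n`. -/
theorem exists_unitIntegral_radauPoly_mul (n : ℕ) :
    ∃ J < 0, ∀ g : ℝ[X], g.natDegree ≤ n →
      unitIntegral (radauPoly (n + 1) * g) = g.coeff n * J := by
  set W : ℝ[X] := X ^ n * (X - 1) ^ (n + 1) with hW
  refine ⟨(-1) ^ n * n.factorial * unitIntegral W, ?_, fun g hg => ?_⟩
  · have hpos : 0 < unitIntegral (C ((-1) ^ (n + 1)) * W) := by
      rw [unitIntegral_apply]
      refine intervalIntegral.intervalIntegral_pos_of_pos_on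
        ((C ((-1) ^ (n + 1)) * W).continuous.intervalIntegrable _ _) (fun x hx => ?_) zero_lt_one
      have : (C ((-1) ^ (n + 1)) * W).eval x = x ^ n * (1 - x) ^ (n + 1) := by
        simp only [hW, eval_mul, eval_C, eval_pow, eval_X, eval_sub, eval_one]
        rw [mul_left_comm, ← mul_pow]
        ring
      rw [this]
      exact mul_pos (pow_pos hx.1 _) (pow_pos (sub_pos.mpr hx.2) _)
    rw [← smul_eq_C_mul, map_smul, smul_eq_mul, pow_succ] at hpos
    have hfac : (0 : ℝ) < n.factorial := by exact_mod_cast n.factorial_pos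
    nlinarith
  · have h0 : (X - C (0 : ℝ)) ^ n ∣ W := by simp [hW]
    have h1 : (X - C (1 : ℝ)) ^ (n + 1) ∣ W := by simp [hW]
    have key := unitIntegral_iterate_derivative_mul W n
      (fun k hk => eval_iterate_derivative_eq_zero_of_pow_dvd h0 hk)
      (fun k hk => eval_iterate_derivative_eq_zero_of_pow_dvd h1 (hk.trans n.lt_succ_self)) g
    rw [iterate_derivative_eq_C_of_natDegree_le hg, mul_comm W, ← smul_eq_C_mul, map_smul,
      smul_eq_mul] at key
    have hr : radauPoly (n + 1) = derivative^[n] W := rfl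
    rw [hr, key]
    ring

theorem natDegree_radauPoly_le (n : ℕ) : (radauPoly (n + 1)).natDegree ≤ n + 1 := by
  refine (natDegree_iterate_derivative _ _).trans ?_
  have h : (X ^ (n + 1 - 1) * (X - 1) ^ (n + 1) : ℝ[X]).natDegree ≤ n + (n + 1) := by
    compute_degree
  omega

theorem coeff_radauPoly_pos (n : ℕ) : 0 < (radauPoly (n + 1)).coeff (n + 1) := by
  have hm : (X ^ n * (X - C 1) ^ (n + 1) : ℝ[X]).Monic :=
    (monic_X_pow n).mul ((monic_X_sub_C 1).pow _)
  have hd : (X ^ n * (X - C 1) ^ (n + 1) : ℝ[X]).natDegree = n + 1 + n := by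
    rw [(monic_X_pow n).natDegree_mul ((monic_X_sub_C 1).pow _), natDegree_X_pow, natDegree_pow,
      natDegree_X_sub_C]
    ring
  have hc : (X ^ n * (X - C 1) ^ (n + 1) : ℝ[X]).coeff (n + 1 + n) = 1 := by
    rw [← hd]
    exact hm
  rw [radauPoly, Nat.add_sub_cancel, coeff_iterate_derivative, ← C_1, hc, nsmul_eq_mul, mul_one]
  exact_mod_cast Nat.descFactorial_pos.mpr (by omega)

/-- A polynomial of degree at most `n + 1` vanishing at the nodes is a multiple of the Radau
polynomial. -/
theorem exists_eq_C_mul_radauPoly {n : ℕ} {c : Fin (n + 1) → ℝ} (hc : Function.Injective c)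
    (hroot : ∀ j, (radauPoly (n + 1)).IsRoot (c j)) {f : ℝ[X]} (hf : f.natDegree ≤ n + 1)
    (hz : ∀ j, f.eval (c j) = 0) :
    ∃ κ : ℝ, f = C κ * radauPoly (n + 1) ∧
      κ * (radauPoly (n + 1)).coeff (n + 1) = f.coeff (n + 1) := by
  have hL := (coeff_radauPoly_pos n).ne'
  set L := (radauPoly (n + 1)).coeff (n + 1)
  refine ⟨f.coeff (n + 1) / L, ?_, div_mul_cancel₀ _ hL⟩
  rw [← sub_eq_zero]
  refine eq_zero_of_degree_lt_of_eval_index_eq_zero Finset.univ hc.injOn ?_ ?_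
  · rw [Finset.card_univ, Fintype.card_fin, degree_lt_iff_coeff_zero]
    intro m hm
    rw [coeff_sub, coeff_C_mul]
    rcases hm.eq_or_lt with rfl | hm
    · exact sub_eq_zero.mpr (div_mul_cancel₀ _ hL).symm
    · rw [coeff_eq_zero_of_natDegree_lt (hf.trans_lt hm),
        coeff_eq_zero_of_natDegree_lt ((natDegree_radauPoly_le n).trans_lt hm), mul_zero, sub_zero]
  · intro j _
    rw [eval_sub, eval_mul, hz, (hroot j).eq_zero, mul_zero, sub_zero]

/-- Under `C(s)`, the matrix `a` integrates the interpolation polynomial of its argument. -/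
theorem exists_interpolant_antiderivative {n : ℕ} {c : Fin (n + 1) → ℝ}
    (hc : Function.Injective c) {a : Matrix (Fin (n + 1)) (Fin (n + 1)) ℝ}
    (ha : ∀ i, ∀ k : ℕ, 1 ≤ k → k ≤ n + 1 →
      ∑ j, a i j * c j ^ (k - 1) = c i ^ k / (k : ℝ)) (v : Fin (n + 1) → ℝ) :
    ∃ Q : ℝ[X], Q.natDegree ≤ n + 1 ∧ Q.eval 0 = 0 ∧ (∀ j, (derivative Q).eval (c j) = v j) ∧
      ∀ i, Q.eval (c i) = (a.mulVec v) i := by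
  set q := Lagrange.interpolate Finset.univ c v
  have hqv : ∀ j, q.eval (c j) = v j := fun j =>
    Lagrange.eval_interpolate_at_node v hc.injOn (Finset.mem_univ j)
  have hq : q.natDegree < n + 1 := by
    have h : q.degree < ((n + 1 : ℕ) : WithBot ℕ) := by
      have h := Lagrange.degree_interpolate_lt (s := Finset.univ) v hc.injOn
      rwa [Finset.card_univ, Fintype.card_fin] at h
    rcases eq_or_ne q 0 with h0 | h0
    · simp [h0]
    · exact (natDegree_lt_iff_degree_lt h0).mpr h
  refine ⟨∑ k ∈ Finset.range (n + 1), C (q.coeff k / ((k + 1 : ℕ) : ℝ)) * X ^ (k + 1),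
    ?_, ?_, fun j => ?_, fun i => ?_⟩
  · refine natDegree_sum_le_of_forall_le _ _ fun k hk => ?_
    exact (natDegree_C_mul_X_pow_le _ _).trans (Finset.mem_range.mp hk)
  · simp [eval_finsetSum]
  · rw [← hqv j]
    congr 1
    conv_rhs => rw [q.as_sum_range_C_mul_X_pow' hq]
    rw [derivative_sum]
    refine Finset.sum_congr rfl fun k _ => ?_
    rw [derivative_C_mul_X_pow, Nat.add_sub_cancel,
      div_mul_cancel₀ _ (Nat.cast_ne_zero.mpr k.succ_ne_zero)]
  · simp only [Matrix.mulVec, dotProduct, ← hqv, eval_eq_sum_range' hq, eval_finsetSum, eval_mul,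
      eval_C, eval_pow, eval_X, Finset.mul_sum]
    rw [Finset.sum_comm]
    refine Finset.sum_congr rfl fun k hk => ?_
    have h := ha i (k + 1) (Nat.succ_pos k) (Finset.mem_range.mp hk)
    rw [Nat.add_sub_cancel] at h
    rw [div_mul_eq_mul_div, mul_div_assoc, ← h, Finset.mul_sum]
    exact Finset.sum_congr rfl fun j _ => by ring

theorem pos_of_mulVec_eq_of_radauIIA {n : ℕ} {c : Fin (n + 1) → ℝ} (hc : Function.Injective c)
    (hroot : ∀ j, (radauPoly (n + 1)).IsRoot (c j))
    {a : Matrix (Fin (n + 1)) (Fin (n + 1)) ℝ}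
    (ha : ∀ i, ∀ k : ℕ, 1 ≤ k → k ≤ n + 1 →
      ∑ j, a i j * c j ^ (k - 1) = c i ^ k / (k : ℝ))
    {v w : Fin (n + 1) → ℝ} (hvw : ¬ (v = 0 ∧ w = 0)) {α β : ℝ}
    (hv : a.mulVec v = α • v - β • w) (hw : a.mulVec w = α • w + β • v) : 0 < α := by
  obtain ⟨P, hPdeg, hP0, hPv, hPa⟩ := exists_interpolant_antiderivative hc ha v
  obtain ⟨Q, hQdeg, hQ0, hQv, hQa⟩ := exists_interpolant_antiderivative hc ha w
  have hP' : (derivative P).natDegree ≤ n := by rw [natDegree_derivative]; omega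
  have hQ' : (derivative Q).natDegree ≤ n := by rw [natDegree_derivative]; omega
  obtain ⟨κ, hκ, hκL⟩ := exists_eq_C_mul_radauPoly hc hroot
    (f := P - C α * derivative P + C β * derivative Q)
    (by compute_degree; omega) (fun j => by simp [hPv, hQv, hPa, hv])
  obtain ⟨μ, hμ, hμL⟩ := exists_eq_C_mul_radauPoly hc hroot
    (f := Q - C α * derivative Q - C β * derivative P)
    (by compute_degree; omega) (fun j => by simp [hPv, hQv, hQa, hw])
  have hL := coeff_radauPoly_pos n
  obtain ⟨J, hJ, hJg⟩ := exists_unitIntegral_radauPoly_mul n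
  set L := (radauPoly (n + 1)).coeff (n + 1)
  have hn : (0 : ℝ) < n + 1 := by positivity
  have hP1 : (derivative P).coeff n = κ * L * (n + 1) := by
    rw [hκL]
    simp [coeff_eq_zero_of_natDegree_lt (Nat.lt_succ_of_le hP'),
      coeff_eq_zero_of_natDegree_lt (Nat.lt_succ_of_le hQ'), coeff_derivative P n]
  have hQ1 : (derivative Q).coeff n = μ * L * (n + 1) := by
    rw [hμL]
    simp [coeff_eq_zero_of_natDegree_lt (Nat.lt_succ_of_le hP'),
      coeff_eq_zero_of_natDegree_lt (Nat.lt_succ_of_le hQ'), coeff_derivative Q n]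
  have hpoly : P * derivative P + Q * derivative Q
      = α • (derivative P * derivative P) + α • (derivative Q * derivative Q)
        + κ • (radauPoly (n + 1) * derivative P) + μ • (radauPoly (n + 1) * derivative Q) := by
    simp only [smul_eq_C_mul]
    linear_combination derivative P * hκ + derivative Q * hμ
  have hint := congrArg unitIntegral hpoly
  simp only [map_add, map_smul, smul_eq_mul] at hint
  rw [hJg _ hP', hJg _ hQ', hP1, hQ1] at hint
  have hPP := unitIntegral_mul_self_nonneg (derivative P)
  have hQQ := unitIntegral_mul_self_nonneg (derivative Q)
  have hPP' := unitIntegral_mul_derivative_nonneg P hP0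
  have hQQ' := unitIntegral_mul_derivative_nonneg Q hQ0
  have hκμ : 0 < κ ^ 2 + μ ^ 2 := by
    by_contra hneg
    have hκ0 : κ = 0 := by nlinarith [sq_nonneg κ, sq_nonneg μ]
    have hμ0 : μ = 0 := by nlinarith [sq_nonneg κ, sq_nonneg μ]
    rw [hκ0, C_0, zero_mul] at hκ
    rw [hμ0, C_0, zero_mul] at hμ
    have hPeq : P = C α * derivative P - C β * derivative Q := by linear_combination hκ
    have hQeq : Q = C α * derivative Q + C β * derivative P := by linear_combination hμ
    have hPle : P.natDegree ≤ max (derivative P).natDegree (derivative Q).natDegree := by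
      conv_lhs => rw [hPeq]
      exact (natDegree_sub_le _ _).trans
        (max_le_max (natDegree_C_mul_le _ _) (natDegree_C_mul_le _ _))
    have hQle : Q.natDegree ≤ max (derivative Q).natDegree (derivative P).natDegree := by
      conv_lhs => rw [hQeq]
      exact (natDegree_add_le _ _).trans
        (max_le_max (natDegree_C_mul_le _ _) (natDegree_C_mul_le _ _))
    rw [natDegree_derivative, natDegree_derivative] at hPle hQle
    refine hvw ⟨funext fun j => ?_, funext fun j => ?_⟩
    · rw [← hPv j, derivative_of_natDegree_zero (by omega)]
      simp
    · rw [← hQv j, derivative_of_natDegree_zero (by omega)]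
      simp
  have hneg : (κ ^ 2 + μ ^ 2) * (L * (n + 1) * J) < 0 :=
    mul_neg_of_pos_of_neg hκμ (mul_neg_of_pos_of_neg (by positivity) hJ)
  have hα : 0 < α * (unitIntegral (derivative P * derivative P)
      + unitIntegral (derivative Q * derivative Q)) := by linarith
  exact pos_of_mul_pos_left hα (by linarith)

theorem exists_mulVec_eq_smul_of_isRoot_charpoly {ι K : Type*} [Fintype ι] [DecidableEq ι]
    [Field K] {A : Matrix ι ι K} {μ : K} (h : A.charpoly.IsRoot μ) :
    ∃ v ≠ 0, A.mulVec v = μ • v := by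
  rw [IsRoot, Matrix.eval_charpoly] at h
  obtain ⟨v, hv, hAv⟩ := Matrix.exists_mulVec_eq_zero_iff.mpr h
  refine ⟨v, hv, ?_⟩
  rw [Matrix.sub_mulVec, sub_eq_zero] at hAv
  simpa using hAv.symm

theorem re_pos_of_mulVec_eq_smul_of_radauIIA {n : ℕ} {c : Fin (n + 1) → ℝ}
    (hc : Function.Injective c) (hroot : ∀ j, (radauPoly (n + 1)).IsRoot (c j))
    {a : Matrix (Fin (n + 1)) (Fin (n + 1)) ℝ}
    (ha : ∀ i, ∀ k : ℕ, 1 ≤ k → k ≤ n + 1 →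
      ∑ j, a i j * c j ^ (k - 1) = c i ^ k / (k : ℝ))
    {v : Fin (n + 1) → ℂ} (hv : v ≠ 0) {lam : ℂ}
    (h : (a.map Complex.ofReal).mulVec v = lam • v) : 0 < lam.re := by
  refine pos_of_mulVec_eq_of_radauIIA hc hroot ha (v := fun j => (v j).re)
    (w := fun j => (v j).im) (β := lam.im) (fun h0 => hv ?_) ?_ ?_
  · exact funext fun j => Complex.ext (congrFun h0.1 j) (congrFun h0.2 j)
  · ext i
    simpa [Matrix.mulVec, dotProduct] using congrArg Complex.re (congrFun h i)
  · ext i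
    simpa [Matrix.mulVec, dotProduct] using congrArg Complex.im (congrFun h i)

/-- Every eigenvalue of the Radau IIA coefficient matrix `a` (i.e. every
complex root of its characteristic polynomial) has strictly positive real
part; consequently so does every eigenvalue of `a⁻¹`. -/
theorem radauIIA_eigenvalues_positive_re (s : ℕ) (hs : 1 ≤ s)
    (c : Fin s → ℝ) (hc : Function.Injective c)
    (hroot : ∀ j, (radauPoly s).IsRoot (c j))
    (hall : ∀ x : ℝ, (radauPoly s).IsRoot x → x ∈ Set.range c)
    (a : Matrix (Fin s) (Fin s) ℝ)
    (ha : ∀ i, ∀ k : ℕ, 1 ≤ k → k ≤ s →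
      ∑ j, a i j * c j ^ (k - 1) = c i ^ k / (k : ℝ)) :
    (∀ lam : ℂ, (a.map Complex.ofReal).charpoly.IsRoot lam → 0 < lam.re) ∧
      (∀ mu : ℂ, ((a⁻¹).map Complex.ofReal).charpoly.IsRoot mu → 0 < mu.re) := by
  obtain ⟨n, rfl⟩ := Nat.exists_eq_add_of_le' hs
  have hpos : ∀ lam : ℂ, ∀ v ≠ 0, (a.map Complex.ofReal).mulVec v = lam • v → 0 < lam.re :=
    fun _ _ hv h => re_pos_of_mulVec_eq_smul_of_radauIIA hc hroot ha hv h
  refine ⟨fun lam hlam => ?_, fun mu hmu => ?_⟩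
  · obtain ⟨v, hv, h⟩ := exists_mulVec_eq_smul_of_isRoot_charpoly hlam
    exact hpos lam v hv h
  · have hdet : IsUnit a.det := by
      rw [isUnit_iff_ne_zero]
      intro h0
      have h0' : (a.map Complex.ofReal).det = 0 := by
        have := (Complex.ofRealHom.map_det a).symm
        rw [h0, map_zero] at this
        exact this
      obtain ⟨v, hv, h⟩ := Matrix.exists_mulVec_eq_zero_iff.mpr h0'
      simpa using hpos 0 v hv (by rw [h, zero_smul])
    have hmul : a.map Complex.ofReal * (a⁻¹).map Complex.ofReal = 1 := by
      have := Matrix.map_mul (L := a) (M := a⁻¹) (f := Complex.ofRealHom)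
      rw [Matrix.mul_nonsing_inv a hdet, Matrix.map_one _ (map_zero _) (map_one _)] at this
      exact this.symm
    obtain ⟨v, hv, h⟩ := exists_mulVec_eq_smul_of_isRoot_charpoly hmu
    have hva : mu • (a.map Complex.ofReal).mulVec v = v := by
      rw [← Matrix.mulVec_smul, ← h, Matrix.mulVec_mulVec, hmul, Matrix.one_mulVec]
    have hmu0 : mu ≠ 0 := by
      rintro rfl
      exact hv (by rw [← hva, zero_smul])
    have hinv := hpos mu⁻¹ v hv (by
      conv_rhs => rw [← hva]
      rw [inv_smul_smul₀ hmu0])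
    rw [Complex.inv_re] at hinv
    exact (div_pos_iff_of_pos_right (Complex.normSq_pos.mpr hmu0)).mp hinv
end
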